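/- In the Hopf algebra H = O_nc(B) = k⟨c, d^{±1}⟩[a^{±1}] (quotient of O_nc(GL₂) by (b), with Δ(a)=a⊗a, Δ(d)=d⊗d, Δ(c)=c⊗a+d⊗c), suppose u ∈ H lies in the two-sided ideal generated by c and satisfies Δ(u) = t ⊗ u + u ⊗ t for some grouplike t. Then u = 0. Consequently, every finite-dimensional O_nc(B)-comodule all of whose O(T)-weights equal a fixed t is defined over O(T), i.e. its coaction factors through O(T) ⊗ V. -/

import Mathlib

open TensorProduct

/-- The generators `a, a⁻¹, c, d, d⁻¹` of `O_nc(B) = k⟨c, d^{±1}⟩[a^{±1}]`. -/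
inductive BGen : Type
  | a : BGen
  | ai : BGen
  | c : BGen
  | d : BGen
  | di : BGen
  deriving DecidableEq

open BGen

namespace BRel

variable (k : Type) [Field k]

local notation "ι" => FreeAlgebra.ι k (X := BGen)

/-- The defining relations of `O_nc(B) = k⟨c, d^{±1}⟩[a^{±1}]`:
`a` is invertible and central, `d` is invertible. -/
inductive rel : FreeAlgebra k BGen → FreeAlgebra k BGen → Prop
  | aai : rel (ι a * ι ai) 1
  | aia : rel (ι ai * ι a) 1
  | ddi : rel (ι d * ι di) 1
  | did : rel (ι di * ι d) 1
  | ac : rel (ι a * ι c) (ι c * ι a)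
  | ad : rel (ι a * ι d) (ι d * ι a)
  | adi : rel (ι a * ι di) (ι di * ι a)
  | aic : rel (ι ai * ι c) (ι c * ι ai)
  | aid : rel (ι ai * ι d) (ι d * ι ai)
  | aidi : rel (ι ai * ι di) (ι di * ι ai)

end BRel

/-- The algebra `O_nc(B)`. -/
abbrev OncB (k : Type) [Field k] : Type := RingQuot (BRel.rel k)

/-- Images of the generators. -/
noncomputable def bg (k : Type) [Field k] (g : BGen) : OncB k :=
  RingQuot.mkAlgHom k (BRel.rel k) (FreeAlgebra.ι k g)

/-- The two-sided ideal of `O_nc(B)` generated by `c`, as a subspace. -/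
noncomputable def cIdeal (k : Type) [Field k] : Submodule k (OncB k) :=
  Submodule.span k {z | ∃ x y : OncB k, z = x * bg k c * y}

/-- The subalgebra `O(T) = k[a^{±1}, d^{±1}] ⊆ O_nc(B)`, spanned by `c`-free monomials. -/
noncomputable def torusPart (k : Type) [Field k] : Submodule k (OncB k) :=
  Submodule.span k {x | ∃ l : List BGen, BGen.c ∉ l ∧ x = (l.map (bg k)).prod}


section Helpers

variable {k : Type} [Field k]

theorem OncB_hom_ext {B : Type*} [Semiring B] [Algebra k B] {f g : OncB k →ₐ[k] B}
    (h : ∀ x : BGen, f (bg k x) = g (bg k x)) : f = g := by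
  apply RingQuot.ringQuot_ext'
  apply FreeAlgebra.hom_ext
  funext x
  exact h x

theorem OncB_lift_exists {B : Type*} [Semiring B] [Algebra k B] (f : BGen → B)
    (h1 : f a * f ai = 1) (h2 : f ai * f a = 1) (h3 : f d * f di = 1) (h4 : f di * f d = 1)
    (h5 : ∀ x, f a * f x = f x * f a) (h6 : ∀ x, f ai * f x = f x * f ai) :
    ∃ F : OncB k →ₐ[k] B, ∀ x, F (bg k x) = f x := by
  refine ⟨RingQuot.liftAlgHom k ⟨FreeAlgebra.lift k f, ?_⟩, ?_⟩
  · intro x y hxy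
    induction hxy <;> simp [h1, h2, h3, h4, h5, h6]
  · intro x
    simp [bg, RingQuot.liftAlgHom_mkAlgHom_apply]

theorem bg_rel {x y : FreeAlgebra k BGen} (h : BRel.rel k x y) :
    RingQuot.mkAlgHom k (BRel.rel k) x = RingQuot.mkAlgHom k (BRel.rel k) y :=
  RingQuot.mkAlgHom_rel k h

theorem bg_aai : bg k a * bg k ai = 1 := by
  simpa [bg] using bg_rel (k := k) BRel.rel.aai
theorem bg_aia : bg k ai * bg k a = 1 := by
  simpa [bg] using bg_rel (k := k) BRel.rel.aia
theorem bg_ddi : bg k d * bg k di = 1 := by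
  simpa [bg] using bg_rel (k := k) BRel.rel.ddi
theorem bg_did : bg k di * bg k d = 1 := by
  simpa [bg] using bg_rel (k := k) BRel.rel.did
theorem bg_a_comm (x : BGen) : bg k a * bg k x = bg k x * bg k a := by
  cases x
  · rfl
  · rw [bg_aai, bg_aia]
  · simpa [bg] using bg_rel (k := k) BRel.rel.ac
  · simpa [bg] using bg_rel (k := k) BRel.rel.ad
  · simpa [bg] using bg_rel (k := k) BRel.rel.adi
theorem bg_ai_comm (x : BGen) : bg k ai * bg k x = bg k x * bg k ai := by
  cases x
  · rw [bg_aai, bg_aia]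
  · rfl
  · simpa [bg] using bg_rel (k := k) BRel.rel.aic
  · simpa [bg] using bg_rel (k := k) BRel.rel.aid
  · simpa [bg] using bg_rel (k := k) BRel.rel.aidi

/-- The projection killing `c` exists. -/
theorem exists_pi : ∃ π : OncB k →ₐ[k] OncB k, π (bg k a) = bg k a ∧ π (bg k ai) = bg k ai ∧
    π (bg k d) = bg k d ∧ π (bg k di) = bg k di ∧ π (bg k c) = 0 := by
  obtain ⟨F, hF⟩ := OncB_lift_exists (k := k)
    (fun x => match x with
      | BGen.c => (0 : OncB k)
      | y => bg k y) bg_aai bg_aia bg_ddi bg_did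
    (by intro x; cases x <;> simp [bg_a_comm]) (by intro x; cases x <;> simp [bg_ai_comm])
  exact ⟨F, hF a, hF ai, hF d, hF di, hF c⟩

open LaurentPolynomial in
theorem T_aux1 : (T 1 : k[T;T⁻¹]) * T (-1) = 1 := by rw [← T_add]; exact T_zero

open LaurentPolynomial in
theorem T_aux2 : (T (-1) : k[T;T⁻¹]) * T 1 = 1 := by rw [← T_add]; exact T_zero

/-- The character `a ↦ p`, `d ↦ 1`, `c ↦ 0` exists. -/
theorem exists_lam {A : Type*} [CommRing A] [Algebra k A] (p q : A) (hpq : p * q = 1) :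
    ∃ l : OncB k →ₐ[k] A, l (bg k a) = p ∧ l (bg k ai) = q ∧
    l (bg k d) = 1 ∧ l (bg k di) = 1 ∧ l (bg k c) = 0 := by
  obtain ⟨F, hF⟩ := OncB_lift_exists (k := k)
    (fun x => match x with
      | BGen.a => p
      | BGen.ai => q
      | BGen.c => 0
      | BGen.d => 1
      | BGen.di => 1) hpq ((mul_comm _ _).trans hpq) (by simp) (by simp)
    (fun x => mul_comm _ _) (fun x => mul_comm _ _)
  exact ⟨F, hF a, hF ai, hF d, hF di, hF c⟩

theorem exists_phi0 {A : Type*} [CommRing A] [Algebra k A] (p q : A) (hpq : p * q = 1)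
    (hqp : q * p = 1) : ∃ f : OncB k →ₐ[k] A ⊗[k] OncB k,
    f (bg k a) = q ⊗ₜ bg k a ∧ f (bg k ai) = p ⊗ₜ bg k ai ∧
    f (bg k d) = 1 ⊗ₜ bg k d ∧ f (bg k di) = 1 ⊗ₜ bg k di ∧ f (bg k c) = 1 ⊗ₜ bg k c := by
  obtain ⟨F, hF⟩ := OncB_lift_exists (k := k)
    (fun x => (match x with
      | BGen.a => q
      | BGen.ai => p
      | BGen.c => 1
      | BGen.d => 1
      | BGen.di => 1) ⊗ₜ[k] bg k x)
    (by simp [hqp, bg_aai, Algebra.TensorProduct.one_def])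
    (by simp [hpq, bg_aia, Algebra.TensorProduct.one_def])
    (by simp [bg_ddi, Algebra.TensorProduct.one_def])
    (by simp [bg_did, Algebra.TensorProduct.one_def])
    (fun x => by simp only [Algebra.TensorProduct.tmul_mul_tmul]; rw [bg_a_comm, mul_comm])
    (fun x => by simp only [Algebra.TensorProduct.tmul_mul_tmul]; rw [bg_ai_comm, mul_comm])
  exact ⟨F, hF a, hF ai, hF d, hF di, hF c⟩

open Polynomial in
theorem exists_E0 : ∃ f : OncB k →ₐ[k] k[X] ⊗[k] OncB k,
    f (bg k a) = 1 ⊗ₜ bg k a ∧ f (bg k ai) = 1 ⊗ₜ bg k ai ∧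
    f (bg k d) = 1 ⊗ₜ bg k d ∧ f (bg k di) = 1 ⊗ₜ bg k di ∧ f (bg k c) = X ⊗ₜ bg k c := by
  obtain ⟨F, hF⟩ := OncB_lift_exists (k := k)
    (fun x => (match x with
      | BGen.c => (X : k[X])
      | _ => 1) ⊗ₜ[k] bg k x)
    (by simp [bg_aai, Algebra.TensorProduct.one_def])
    (by simp [bg_aia, Algebra.TensorProduct.one_def])
    (by simp [bg_ddi, Algebra.TensorProduct.one_def])
    (by simp [bg_did, Algebra.TensorProduct.one_def])
    (fun x => by simp only [Algebra.TensorProduct.tmul_mul_tmul]; rw [bg_a_comm, mul_comm])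
    (fun x => by simp only [Algebra.TensorProduct.tmul_mul_tmul]; rw [bg_ai_comm, mul_comm])
  exact ⟨F, hF a, hF ai, hF d, hF di, hF c⟩

open LaurentPolynomial in
/-- The key construction: a character `l` killing `c` and a linear `S` which recovers the identity
from the left coaction of `l` and the projection `π` from its right coaction. -/
theorem key (Δ : OncB k →ₐ[k] OncB k ⊗[k] OncB k)
    (hΔa : Δ (bg k a) = bg k a ⊗ₜ bg k a)
    (hΔai : Δ (bg k ai) = bg k ai ⊗ₜ bg k ai)
    (hΔd : Δ (bg k d) = bg k d ⊗ₜ bg k d)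
    (hΔdi : Δ (bg k di) = bg k di ⊗ₜ bg k di)
    (hΔc : Δ (bg k c) = bg k c ⊗ₜ bg k a + bg k d ⊗ₜ bg k c)
    (π : OncB k →ₐ[k] OncB k)
    (ha : π (bg k a) = bg k a) (hai : π (bg k ai) = bg k ai) (hd : π (bg k d) = bg k d)
    (hdi : π (bg k di) = bg k di) (hc : π (bg k c) = 0) :
    ∃ (l : OncB k →ₐ[k] k[T;T⁻¹]) (S : k[T;T⁻¹] ⊗[k] OncB k →ₗ[k] OncB k),
      l (bg k c) = 0 ∧ (∀ x, l (π x) = l x) ∧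
      (S ∘ₗ TensorProduct.map l.toLinearMap LinearMap.id ∘ₗ Δ.toLinearMap = LinearMap.id) ∧
      (S ∘ₗ (TensorProduct.comm k _ _).toLinearMap ∘ₗ
        TensorProduct.map LinearMap.id l.toLinearMap ∘ₗ Δ.toLinearMap = π.toLinearMap) := by
  obtain ⟨p, hp⟩ : ∃ p : k[T;T⁻¹], p = T 1 := ⟨_, rfl⟩
  obtain ⟨q, hq⟩ : ∃ q : k[T;T⁻¹], q = T (-1) := ⟨_, rfl⟩
  have hpq : p * q = 1 := by rw [hp, hq]; exact T_aux1
  have hqp : q * p = 1 := by rw [hp, hq]; exact T_aux2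
  have hX : Polynomial.toLaurent (Polynomial.X : Polynomial k) = p := by
    rw [hp]; exact Polynomial.toLaurent_X
  obtain ⟨l, la, lai, ld, ldi, lc⟩ := exists_lam (k := k) p q hpq
  obtain ⟨f, fa, fai, fd, fdi, fc⟩ := exists_phi0 (k := k) p q hpq hqp
  obtain ⟨e, ea, eai, ed, edi, ec⟩ := exists_E0 (k := k)
  let Φ : k[T;T⁻¹] ⊗[k] OncB k →ₐ[k] k[T;T⁻¹] ⊗[k] OncB k :=
    Algebra.TensorProduct.lift Algebra.TensorProduct.includeLeft f (by
      intro p y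
      induction f y with
      | zero => exact Commute.zero_right _
      | tmul q z => simp [Commute, SemiconjBy, mul_comm]
      | add u v hu hv => exact hu.add_right hv)
  have hΦ : ∀ p y, Φ (p ⊗ₜ y) = (p ⊗ₜ 1) * f y := fun p y => by
    simp [Φ]
  let s : k[T;T⁻¹] →ₗ[k] k := Finsupp.lapply 0 ∘ₗ (AddMonoidAlgebra.coeffLinearEquiv k).toLinearMap
  let S : k[T;T⁻¹] ⊗[k] OncB k →ₗ[k] OncB k :=
    (TensorProduct.lid k _).toLinearMap ∘ₗ TensorProduct.map s LinearMap.id ∘ₗ Φ.toLinearMap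
  let F : OncB k →ₐ[k] k[T;T⁻¹] ⊗[k] OncB k :=
    (Algebra.TensorProduct.map l (AlgHom.id k _)).comp Δ
  let G : OncB k →ₐ[k] k[T;T⁻¹] ⊗[k] OncB k :=
    ((Algebra.TensorProduct.comm k _ _).toAlgHom.comp
      (Algebra.TensorProduct.map (AlgHom.id k _) l)).comp Δ
  have hF : Φ.comp F = Algebra.TensorProduct.includeRight := by
    apply OncB_hom_ext
    intro x
    cases x <;> simp [F, hΔa, hΔai, hΔd, hΔdi, hΔc, la, lai, ld, ldi, lc, hΦ, fa, fai, fd, fdi, fc,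
      hpq, hqp, hX, -Polynomial.toLaurent_X]
  have hG : Φ.comp G = (Algebra.TensorProduct.map Polynomial.toLaurentAlg (AlgHom.id k _)).comp e := by
    apply OncB_hom_ext
    intro x
    cases x <;> simp [G, hΔa, hΔai, hΔd, hΔdi, hΔc, la, lai, ld, ldi, lc, hΦ, fa, fai, fd, fdi, fc,
      ea, eai, ed, edi, ec, hpq, hqp, hX, -Polynomial.toLaurent_X]
  have he : ((Algebra.TensorProduct.lid k _).toAlgHom.comp
      (Algebra.TensorProduct.map (Polynomial.aeval (0 : k)) (AlgHom.id k _))).comp e = π := by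
    apply OncB_hom_ext
    intro x
    cases x <;> simp [ea, eai, ed, edi, ec, ha, hai, hd, hdi, hc]
  have hs : s ∘ₗ Polynomial.toLaurentAlg.toLinearMap = (Polynomial.aeval (0 : k)).toLinearMap := by
    apply Polynomial.lhom_ext'
    intro n
    ext
    simp [s, AddMonoidAlgebra.coeffLinearEquiv, zero_pow_eq]
  refine ⟨l, S, lc, ?_, ?_, ?_⟩
  · intro x
    have : l.comp π = l := by
      apply OncB_hom_ext
      intro x
      cases x <;> simp [ha, hai, hd, hdi, hc, lc]
    exact DFunLike.congr_fun this x
  · ext x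
    have h1 : Φ (F x) = 1 ⊗ₜ x := DFunLike.congr_fun hF x
    change (TensorProduct.lid k _) (TensorProduct.map s LinearMap.id (Φ (F x))) = x
    rw [h1]
    have : s 1 = 1 := by
      simpa using LinearMap.congr_fun hs 1
    simp [this]
  · ext x
    have h1 : Φ (G x) = TensorProduct.map Polynomial.toLaurentAlg.toLinearMap LinearMap.id (e x) :=
      DFunLike.congr_fun hG x
    change (TensorProduct.lid k _) (TensorProduct.map s LinearMap.id (Φ (G x))) = π x
    rw [h1, ← LinearMap.comp_apply (TensorProduct.map s LinearMap.id), ← TensorProduct.map_comp, hs]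
    exact DFunLike.congr_fun he x

end Helpers

/-- In `H = O_nc(B)` (with `Δ(a) = a⊗a`, `Δ(d) = d⊗d`,
`Δ(c) = c⊗a + d⊗c`): (i) if `u` lies in the two-sided ideal generated by `c` and
`Δ(u) = t ⊗ u + u ⊗ t` for a grouplike `t`, then `u = 0`; (ii) consequently, a
finite-dimensional `H`-comodule `V` all of whose `O(T)`-weights equal a fixed
grouplike `t` (i.e. `(π ⊗ 1)ρ(v) = t ⊗ v` for the projection `π` killing `c`)
is defined over `O(T)`: `ρ(V) ⊆ O(T) ⊗ V`. -/
theorem OncB_primitive_and_weights (k : Type) [Field k]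
    (Δ : OncB k →ₐ[k] OncB k ⊗[k] OncB k)
    (hΔa : Δ (bg k a) = bg k a ⊗ₜ bg k a)
    (hΔai : Δ (bg k ai) = bg k ai ⊗ₜ bg k ai)
    (hΔd : Δ (bg k d) = bg k d ⊗ₜ bg k d)
    (hΔdi : Δ (bg k di) = bg k di ⊗ₜ bg k di)
    (hΔc : Δ (bg k c) = bg k c ⊗ₜ bg k a + bg k d ⊗ₜ bg k c) :
    -- (i)  skew-primitives in the ideal (c) vanish
    (∀ u ∈ cIdeal k, ∀ t : OncB k, t ≠ 0 → Δ t = t ⊗ₜ t →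
      Δ u = t ⊗ₜ u + u ⊗ₜ t → u = 0) ∧
    -- (ii) comodules with a single weight `t` are defined over `O(T)`
    (∀ (ε : OncB k →ₐ[k] k),
      ε (bg k a) = 1 → ε (bg k ai) = 1 → ε (bg k d) = 1 → ε (bg k di) = 1 →
      ε (bg k c) = 0 →
      ∀ (π : OncB k →ₐ[k] OncB k),
      π (bg k a) = bg k a → π (bg k ai) = bg k ai → π (bg k d) = bg k d →
      π (bg k di) = bg k di → π (bg k c) = 0 →
      ∀ (V : Type) [AddCommGroup V] [Module k V] [FiniteDimensional k V],
      ∀ (ρ : V →ₗ[k] OncB k ⊗[k] V),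
      (∀ v, (TensorProduct.assoc k (OncB k) (OncB k) V)
          (TensorProduct.map Δ.toLinearMap LinearMap.id (ρ v))
        = TensorProduct.map LinearMap.id ρ (ρ v)) →
      (∀ v, (TensorProduct.lid k V)
          (TensorProduct.map ε.toLinearMap LinearMap.id (ρ v)) = v) →
      ∀ t : OncB k, t ≠ 0 → Δ t = t ⊗ₜ t → t ∈ torusPart k →
      (∀ v, TensorProduct.map π.toLinearMap LinearMap.id (ρ v) = t ⊗ₜ v) →
      ∀ v, ρ v ∈ Submodule.map₂ (TensorProduct.mk k (OncB k) V) (torusPart k) ⊤) := by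
  constructor
  · intro u hu t _ _ hΔu
    obtain ⟨π, ha, hai, hd, hdi, hc⟩ := exists_pi (k := k)
    obtain ⟨l, S, lc, -, h1, h2⟩ := key Δ hΔa hΔai hΔd hΔdi hΔc π ha hai hd hdi hc
    have hk : π u = 0 ∧ l u = 0 := by
      clear hΔu
      induction hu using Submodule.span_induction with
      | mem x hx => obtain ⟨y, z, rfl⟩ := hx; simp [hc, lc]
      | zero => simp
      | add x y _ _ hx hy => simp [hx.1, hx.2, hy.1, hy.2]
      | smul r x _ hx => simp [hx.1, hx.2]
    have e1 := LinearMap.congr_fun h1 u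
    have e2 := LinearMap.congr_fun h2 u
    simp [hΔu, hk.1, hk.2] at e1 e2
    rw [← e1, e2]
  · intro ε _ _ _ _ _ π ha hai hd hdi hc V _ _ _ ρ hρ _ t _ _ ht hπ v
    obtain ⟨l, S, lc, hlπ, h1, h2⟩ := key Δ hΔa hΔai hΔd hΔdi hΔc π ha hai hd hdi hc
    have hl : ∀ w, TensorProduct.map l.toLinearMap LinearMap.id (ρ w) = l t ⊗ₜ[k] w := by
      intro w
      have h := congrArg (TensorProduct.map l.toLinearMap (LinearMap.id : V →ₗ[k] V)) (hπ w)
      rw [← LinearMap.comp_apply, ← TensorProduct.map_comp] at h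
      have h3 : l.toLinearMap ∘ₗ π.toLinearMap = l.toLinearMap := LinearMap.ext hlπ
      rw [h3] at h
      simpa using h
    have key1 : TensorProduct.map (TensorProduct.map l.toLinearMap LinearMap.id ∘ₗ Δ.toLinearMap)
        LinearMap.id (ρ v) = (TensorProduct.assoc k _ _ _).symm (l t ⊗ₜ[k] ρ v) := by
      have g : ∀ y : (OncB k ⊗[k] OncB k) ⊗[k] V,
          TensorProduct.map (TensorProduct.map l.toLinearMap LinearMap.id) LinearMap.id y =
          (TensorProduct.assoc k _ _ _).symm (TensorProduct.map l.toLinearMap LinearMap.id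
            (TensorProduct.assoc k _ _ _ y)) := by
        intro y
        induction y with
        | zero => simp
        | add p q hp hq => simp only [map_add, hp, hq]
        | tmul p w =>
          induction p with
          | zero => simp
          | add p q hp hq => simp only [map_add, TensorProduct.add_tmul, hp, hq]
          | tmul p q => simp
      have g2 : ∀ z : OncB k ⊗[k] V, TensorProduct.map l.toLinearMap LinearMap.id
          (TensorProduct.map LinearMap.id ρ z) = TensorProduct.map LinearMap.id ρ
          (TensorProduct.map l.toLinearMap LinearMap.id z) := by
        intro z
        simp only [← LinearMap.comp_apply, ← TensorProduct.map_comp, LinearMap.comp_id,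
          LinearMap.id_comp]
      have e : TensorProduct.map (TensorProduct.map l.toLinearMap LinearMap.id ∘ₗ Δ.toLinearMap)
        LinearMap.id (ρ v) = TensorProduct.map (TensorProduct.map l.toLinearMap LinearMap.id)
          LinearMap.id (TensorProduct.map Δ.toLinearMap (LinearMap.id : V →ₗ[k] V) (ρ v)) := by
        conv_rhs => rw [← LinearMap.comp_apply, ← TensorProduct.map_comp, LinearMap.comp_id]
      rw [e, g, hρ, g2, hl, TensorProduct.map_tmul, LinearMap.id_apply]
    have key2 : TensorProduct.map ((TensorProduct.comm k _ _).toLinearMap ∘ₗ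
        TensorProduct.map LinearMap.id l.toLinearMap ∘ₗ Δ.toLinearMap)
        LinearMap.id (ρ v) = (TensorProduct.assoc k _ _ _).symm (l t ⊗ₜ[k] ρ v) := by
      have g : ∀ y : (OncB k ⊗[k] OncB k) ⊗[k] V,
          TensorProduct.map ((TensorProduct.comm k _ _).toLinearMap ∘ₗ
            TensorProduct.map LinearMap.id l.toLinearMap) LinearMap.id y =
          TensorProduct.map (TensorProduct.comm k _ _).toLinearMap LinearMap.id
          ((TensorProduct.assoc k _ _ _).symm (TensorProduct.map LinearMap.id
            (TensorProduct.map l.toLinearMap LinearMap.id) (TensorProduct.assoc k _ _ _ y))) := by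
        intro y
        induction y with
        | zero => simp
        | add p q hp hq => simp only [map_add, hp, hq]
        | tmul p w =>
          induction p with
          | zero => simp
          | add p q hp hq => simp only [map_add, TensorProduct.add_tmul, hp, hq]
          | tmul p q => simp
      have g2 : ∀ z : OncB k ⊗[k] V, TensorProduct.map (TensorProduct.comm k _ _).toLinearMap
          LinearMap.id ((TensorProduct.assoc k _ _ _).symm
          (TensorProduct.map LinearMap.id (TensorProduct.map l.toLinearMap LinearMap.id)
          (TensorProduct.map LinearMap.id ρ z))) =
          (TensorProduct.assoc k _ _ _).symm (l t ⊗ₜ[k] z) := by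
        intro z
        induction z with
        | zero => simp
        | add p q hp hq => simp only [map_add, TensorProduct.tmul_add, hp, hq]
        | tmul p w => simp [hl]
      have e : TensorProduct.map ((TensorProduct.comm k _ _).toLinearMap ∘ₗ
        TensorProduct.map LinearMap.id l.toLinearMap ∘ₗ Δ.toLinearMap)
        LinearMap.id (ρ v) = TensorProduct.map ((TensorProduct.comm k _ _).toLinearMap ∘ₗ
        TensorProduct.map LinearMap.id l.toLinearMap)
          LinearMap.id (TensorProduct.map Δ.toLinearMap (LinearMap.id : V →ₗ[k] V) (ρ v)) := by
        conv_rhs => rw [← LinearMap.comp_apply, ← TensorProduct.map_comp,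
          LinearMap.comp_id, LinearMap.comp_assoc]
      rw [e, g, hρ, g2]
    have f1 := congrArg (TensorProduct.map S (LinearMap.id : V →ₗ[k] V)) (key1.trans key2.symm)
    rw [← LinearMap.comp_apply (TensorProduct.map S _), ← LinearMap.comp_apply (TensorProduct.map S _),
      ← TensorProduct.map_comp, ← TensorProduct.map_comp, h1, h2, LinearMap.comp_id, hπ,
      TensorProduct.map_id, LinearMap.id_apply] at f1
    rw [f1]
    exact Submodule.apply_mem_map₂ _ ht Submodule.mem_top
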